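/- Let i be an index with 1 < i ≤ n and let c := BWT[i]. Set ℓ* := i if w(i) = LCP[i] and ℓ* := i+1 otherwise, and curr_b := b(ℓ*). If at least one of the following conditions holds: (C1) w(i) > LCP[i]; (C2) w(i) > -1 and pIdx(c, i) < curr_b; (C3) pW(c, i) < w(i); then i = Candt_c(curr_b, i+1). -/

import Mathlib

open scoped Classical

/-- `seg T i len` is the string `T[i..i+len-1]`. -/
def seg (T : ℕ → ℤ) (i len : ℕ) : List ℤ :=
  (List.range len).map fun k => T (i + k)

/-- `sfx T n p` is the suffix `T[p..n]` of a length-`n` text. -/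
def sfx (T : ℕ → ℤ) (n p : ℕ) : List ℤ := seg T p (n + 1 - p)

/-- The reversed text: `Trev T n n = T n` and `Trev T n i = T (n - i)` for `i < n`. -/
def Trev (T : ℕ → ℤ) (n : ℕ) : ℕ → ℤ := fun i => if i = n then T n else T (n - i)

/-- Length of the longest common prefix of two strings. -/
def lcpLen : List ℤ → List ℤ → ℕ
  | a :: l₁, b :: l₂ => if a = b then lcpLen l₁ l₂ + 1 else 0
  | _, _ => 0

/-- `s` occurs as a substring of `T[1..n]`. -/
def OccursIn (T : ℕ → ℤ) (n : ℕ) (s : List ℤ) : Prop :=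
  ∃ i : ℕ, 1 ≤ i ∧ i + s.length ≤ n + 1 ∧ s = seg T i s.length

/-- `s` is a right-maximal substring of `T[1..n]` over the alphabet `{1,…,σ}`. -/
def RightMax (T : ℕ → ℤ) (n σ : ℕ) (s : List ℤ) : Prop :=
  ∃ a b : ℤ, a ≠ b ∧ 1 ≤ a ∧ a ≤ (σ : ℤ) ∧ 1 ≤ b ∧ b ≤ (σ : ℤ) ∧
    OccursIn T n (s ++ [a]) ∧ OccursIn T n (s ++ [b])

/-- `X` is a suffixient set for `T[1..n]`. -/
def Suffixient (T : ℕ → ℤ) (n σ : ℕ) (X : Set ℕ) : Prop :=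
  ∀ s : List ℤ, RightMax T n σ s → ∀ c : ℤ, 1 ≤ c → c ≤ (σ : ℤ) →
    OccursIn T n (s ++ [c]) → ∃ x ∈ X, (s ++ [c]) <:+ seg T 1 x

def StartRun (BWT : ℕ → ℤ) (x : ℕ) : Prop := 1 < x ∧ BWT x ≠ BWT (x - 1)

def EndRun (BWT : ℕ → ℤ) (n x : ℕ) : Prop := x < n ∧ BWT x ≠ BWT (x + 1)

def RunBoundary (BWT : ℕ → ℤ) (n x : ℕ) : Prop := StartRun BWT x ∨ EndRun BWT n x

/-- `bIdx L x` : the largest index `y < x` with `L y < L x`, or `1` if none exists. -/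
noncomputable def bIdx (L : ℕ → ℤ) (x : ℕ) : ℕ :=
  sSup {y : ℕ | (1 ≤ y ∧ y < x ∧ L y < L x) ∨ y = 1}

/-- `eIdx L n x` : the smallest index `y > x` with `L y < L x`, or `n+1` if none exists. -/
noncomputable def eIdx (L : ℕ → ℤ) (n x : ℕ) : ℕ :=
  sInf {y : ℕ | (x < y ∧ y ≤ n ∧ L y < L x) ∨ y = n + 1}

/-- The maximal weight `w y` over indices `a ≤ y < a'` with `BWT y = c` and `w y ≥ 0`. -/
noncomputable def wMax (BWT w : ℕ → ℤ) (c : ℤ) (a a' : ℕ) : ℤ :=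
  (sSup {m : ℕ | ∃ q : ℕ, a ≤ q ∧ q < a' ∧ BWT q = c ∧ 0 ≤ w q ∧ (m : ℤ) = w q} : ℕ)

/-- `Candt BWT w c a a'`: the smallest index `a ≤ p < a'` with `BWT p = c` whose weight
attains the maximum weight among such indices; `-1` if no index
`a ≤ y < a'` with `BWT y = c` and `w y ≥ 0` exists. -/
noncomputable def Candt (BWT w : ℕ → ℤ) (c : ℤ) (a a' : ℕ) : ℤ :=
  if ∃ p : ℕ, a ≤ p ∧ p < a' ∧ BWT p = c ∧ 0 ≤ w p then
    ((sInf {p : ℕ | a ≤ p ∧ p < a' ∧ BWT p = c ∧ w p = wMax BWT w c a a'} : ℕ) : ℤ)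
  else -1

def FullL (n : ℕ) (SA : ℕ → ℕ) (BWT LCP w : ℕ → ℤ) : Set ℕ :=
  { q | ∃ x : ℕ, 1 < x ∧ x ≤ n ∧ BWT x ≠ BWT (x - 1) ∧
      ∃ c : ℤ, (c = BWT x ∨ c = BWT (x - 1)) ∧
      ∃ p : ℕ, (p : ℤ) = Candt BWT w c (bIdx LCP x) (eIdx LCP n x) ∧
        q = n - SA p + 1 }

/-- Basic assumptions on the text `T[1..n]` over alphabet `{1,…,σ}` with sentinel `dollar`. -/
structure TextSetup (n σ : ℕ) (T : ℕ → ℤ) (dollar : ℤ) : Prop where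
  hn : 2 ≤ n
  hsigma : 2 ≤ σ
  hsigma_le : σ ≤ n
  hT : ∀ i, 1 ≤ i → i ≤ n → 1 ≤ T i ∧ T i ≤ (σ : ℤ)
  hTn : T n = dollar
  hTne : ∀ i, 1 ≤ i → i < n → T i ≠ dollar

/-- `SA[1..n]` is the suffix array of the reversed text. -/
structure SASetup (n σ : ℕ) (T : ℕ → ℤ) (dollar : ℤ) (SA : ℕ → ℕ)
    extends TextSetup n σ T dollar : Prop where
  hSAmem : ∀ i, 1 ≤ i → i ≤ n → 1 ≤ SA i ∧ SA i ≤ n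
  hSAinj : ∀ i j, 1 ≤ i → i ≤ n → 1 ≤ j → j ≤ n → SA i = SA j → i = j
  hSAsurj : ∀ p, 1 ≤ p → p ≤ n → ∃ i, 1 ≤ i ∧ i ≤ n ∧ SA i = p
  hSAord : ∀ i j, 1 ≤ i → i < j → j ≤ n →
    List.Lex (· < ·) (sfx (Trev T n) n (SA i)) (sfx (Trev T n) n (SA j))

/-- `LCP[1..n]` is the LCP array of the reversed text. -/
structure LCPSetup (n σ : ℕ) (T : ℕ → ℤ) (dollar : ℤ) (SA : ℕ → ℕ) (LCP : ℕ → ℤ)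
    extends SASetup n σ T dollar SA : Prop where
  hLCP1 : LCP 1 = -1
  hLCP : ∀ i, 1 < i → i ≤ n →
    LCP i = (lcpLen (sfx (Trev T n) n (SA (i - 1))) (sfx (Trev T n) n (SA i)) : ℤ)
  hLCPend : LCP (n + 1) = -1

/-- Additionally, `BWT[1..n]` is the BWT of the reversed text and `w` is the weight function. -/
structure FullSetup (n σ : ℕ) (T : ℕ → ℤ) (dollar : ℤ) (SA : ℕ → ℕ)
    (BWT LCP w : ℕ → ℤ) extends LCPSetup n σ T dollar SA LCP : Prop where
  hBWT : ∀ i, 1 ≤ i → i ≤ n → BWT i = T (n - SA i + 1)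
  hBWTend : BWT (n + 1) = -1
  hwNot : ∀ x, 1 ≤ x → x ≤ n → ¬ RunBoundary BWT n x → w x = -1
  hwRB : ∀ x, 1 ≤ x → x ≤ n → RunBoundary BWT n x →
    (∃ s : List ℤ, RightMax T n σ s ∧ s <:+ seg T 1 (n - SA x)) →
    IsGreatest {m : ℤ | ∃ s : List ℤ, RightMax T n σ s ∧ s <:+ seg T 1 (n - SA x) ∧
      m = (s.length : ℤ)} (w x)

/-- `sIdx`: the minimum index `i ∈ [1..n]` such that `T[n-SA[ℓ]+1-w(ℓ)..n-SA[ℓ]]`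
is a suffix of `T[1..n-SA[i]]`. -/
noncomputable def sIdx (T : ℕ → ℤ) (n : ℕ) (SA : ℕ → ℕ) (w : ℕ → ℤ) (l : ℕ) : ℕ :=
  sInf {i : ℕ | 1 ≤ i ∧ i ≤ n ∧
    seg T (n - SA l + 1 - (w l).toNat) (w l).toNat <:+ seg T 1 (n - SA i)}

/-- `tIdx`: the maximum such index. -/
noncomputable def tIdx (T : ℕ → ℤ) (n : ℕ) (SA : ℕ → ℕ) (w : ℕ → ℤ) (l : ℕ) : ℕ :=
  sSup {i : ℕ | 1 ≤ i ∧ i ≤ n ∧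
    seg T (n - SA l + 1 - (w l).toNat) (w l).toNat <:+ seg T 1 (n - SA i)}

/-- `pIdx c i`: the largest index `j < i` with `w j > -1` and `BWT j = c`, or `0`. -/
noncomputable def pIdx (BWT w : ℕ → ℤ) (c : ℤ) (i : ℕ) : ℕ :=
  sSup {j : ℕ | (1 ≤ j ∧ j < i ∧ -1 < w j ∧ BWT j = c) ∨ j = 0}

/-- `pW c i`: the weight of `pIdx c i`, or `-1` if no index as in `pIdx` exists. -/
noncomputable def pW (BWT w : ℕ → ℤ) (c : ℤ) (i : ℕ) : ℤ :=
  if ∃ j : ℕ, 1 ≤ j ∧ j < i ∧ -1 < w j ∧ BWT j = c then w (pIdx BWT w c i) else -1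

/-- `α` is colexicographically smaller than `β`. -/
def ColexLt (α β : List ℤ) : Prop :=
  (α ≠ β ∧ α <:+ β) ∨
  ∃ k : ℕ, 1 ≤ k ∧ k ≤ α.length ∧ k ≤ β.length ∧
    (∀ i, 1 ≤ i → i < k → α.getD (α.length - i) 0 = β.getD (β.length - i) 0) ∧
    α.getD (α.length - k) 0 < β.getD (β.length - k) 0

theorem lcpLen_comm (a b : List ℤ) : lcpLen a b = lcpLen b a := by
  induction a generalizing b with
  | nil => cases b <;> rfl
  | cons x a ih =>
    cases b with
    | nil => rfl
    | cons y b => simp only [lcpLen, ih b, eq_comm]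

theorem lcpLen_le_left (a b : List ℤ) : lcpLen a b ≤ a.length := by
  induction a generalizing b with
  | nil => cases b <;> simp [lcpLen]
  | cons x a ih =>
    cases b with
    | nil => simp [lcpLen]
    | cons y b =>
      have := ih b
      simp only [lcpLen, List.length_cons]
      split_ifs <;> omega

theorem lcpLen_self (a : List ℤ) : lcpLen a a = a.length := by
  induction a with
  | nil => rfl
  | cons x a ih => simp [lcpLen, ih]

/-- The longest-common-prefix length is an ultrametric similarity. -/
theorem min_lcpLen_le (a b c : List ℤ) : min (lcpLen a b) (lcpLen b c) ≤ lcpLen a c := by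
  induction a generalizing b c with
  | nil => cases b <;> simp [lcpLen]
  | cons x a ih =>
    rcases b with _ | ⟨y, b⟩
    · simp [lcpLen]
    rcases c with _ | ⟨z, c⟩
    · simp [lcpLen]
    have := ih b c
    simp only [lcpLen]
    split_ifs <;> omega

theorem lcpLen_le_of_lex {a b c : List ℤ} (hab : List.Lex (· < ·) a b)
    (hbc : List.Lex (· < ·) b c) : lcpLen a c ≤ lcpLen a b := by
  induction a generalizing b c with
  | nil => cases c <;> simp [lcpLen]
  | cons x a ih =>
    cases hab with
    | rel hxy =>
      cases hbc with
      | rel hyz => simp [lcpLen, (hxy.trans hyz).ne]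
      | cons h => simp [lcpLen, hxy.ne]
    | cons h =>
      cases hbc with
      | rel hyz => simp [lcpLen, hyz.ne]
      | cons h' => simpa [lcpLen] using ih h h'

theorem length_le_lcpLen {p a b : List ℤ} (ha : p <+: a) (hb : p <+: b) :
    p.length ≤ lcpLen a b := by
  obtain ⟨u, rfl⟩ := ha
  obtain ⟨v, rfl⟩ := hb
  induction p with
  | nil => simp
  | cons x p ih => simpa [lcpLen] using ih

theorem take_lcpLen_prefix (a b : List ℤ) : a.take (lcpLen a b) <+: b := by
  induction a generalizing b with
  | nil => simp
  | cons x a ih =>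
    cases b with
    | nil => simp [lcpLen]
    | cons y b =>
      by_cases h : x = y
      · simpa [lcpLen, h, List.cons_prefix_cons] using ih b
      · simp [lcpLen, h]

/-- A common terminator that occurs in neither string never extends the common prefix. -/
theorem lcpLen_append_terminator {a b : List ℤ} {d : ℤ} (ha : d ∉ a) (hb : d ∉ b)
    (hab : a ≠ b) : lcpLen (a ++ [d]) (b ++ [d]) = lcpLen a b := by
  induction a generalizing b with
  | nil =>
    cases b with
    | nil => exact absurd rfl hab
    | cons y b =>
      have : d ≠ y := fun h => hb (by simp [h])
      simp [lcpLen, this]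
  | cons x a ih =>
    cases b with
    | nil =>
      have : x ≠ d := fun h => ha (by simp [h])
      simp [lcpLen, this]
    | cons y b =>
      by_cases h : x = y
      · subst h
        simp only [List.cons_append, lcpLen, if_true]
        rw [ih (fun h => ha (by simp [h])) (fun h => hb (by simp [h]))
          (fun h => hab (by rw [h]))]
      · simp [lcpLen, h]

theorem seg_length (T : ℕ → ℤ) (i len : ℕ) : (seg T i len).length = len := by simp [seg]

theorem seg_one_succ (T : ℕ → ℤ) (m : ℕ) : seg T 1 (m + 1) = seg T 1 m ++ [T (m + 1)] := by
  simp [seg, List.range_succ, add_comm]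

theorem seg_add (T : ℕ → ℤ) (i k l : ℕ) : seg T i (k + l) = seg T i k ++ seg T (i + k) l := by
  simp [seg, List.range_add, add_assoc, Function.comp_def]

theorem occursIn_iff_suffix (T : ℕ → ℤ) (n : ℕ) (s : List ℤ) :
    OccursIn T n s ↔ ∃ m ≤ n, s <:+ seg T 1 m := by
  constructor
  · rintro ⟨i, hi, hin, hs⟩
    refine ⟨i - 1 + s.length, by omega, seg T 1 (i - 1), ?_⟩
    have h := seg_add T 1 (i - 1) s.length
    rw [Nat.add_sub_cancel' hi, ← hs] at h
    exact h.symm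
  · rintro ⟨m, hm, t, ht⟩
    have hl : t.length + s.length = m := by
      simpa [seg_length] using congrArg List.length ht
    refine ⟨1 + t.length, by omega, by omega, ?_⟩
    rw [← hl, seg_add] at ht
    exact (List.append_inj' ht (by rw [seg_length])).2

theorem occursIn_append_singleton (T : ℕ → ℤ) (n : ℕ) (s : List ℤ) (a : ℤ) :
    OccursIn T n (s ++ [a]) ↔ ∃ m < n, T (m + 1) = a ∧ s <:+ seg T 1 m := by
  rw [occursIn_iff_suffix]
  constructor
  · rintro ⟨_ | m, hm, h⟩
    · simp [seg] at h
    · rw [seg_one_succ] at h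
      obtain ⟨t, ht⟩ := h
      rw [← List.append_assoc] at ht
      obtain ⟨h₁, h₂⟩ := List.append_inj' ht rfl
      exact ⟨m, hm, by simpa using h₂.symm, t, h₁⟩
  · rintro ⟨m, hm, rfl, t, ht⟩
    exact ⟨m + 1, hm, t, by rw [seg_one_succ, ← ht, List.append_assoc]⟩

theorem sfx_Trev (T : ℕ → ℤ) {n p : ℕ} (hpn : p ≤ n) :
    sfx (Trev T n) n p = (seg T 1 (n - p)).reverse ++ [T n] := by
  have hlen : n + 1 - p = (n - p) + 1 := by omega
  rw [sfx, hlen, seg_add]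
  congr 1
  · apply List.ext_getElem
    · simp [seg]
    · intro k h₁ h₂
      simp only [seg, List.length_map, List.length_range] at h₁
      have h : p + k ≠ n := by omega
      simp only [seg, Trev, List.getElem_map, List.getElem_range, List.getElem_reverse,
        List.length_map, List.length_range, if_neg h]
      congr 1
      omega
  · simp [seg, Trev, Nat.add_sub_cancel' hpn]

theorem terminator_notMem_seg {n : ℕ} {T : ℕ → ℤ} (hT : ∀ i, 1 ≤ i → i < n → T i ≠ T n)
    {m : ℕ} (hm : m < n) : T n ∉ seg T 1 m := by
  simp only [seg, List.mem_map, List.mem_range, not_exists, not_and]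
  intro k hk
  exact hT _ (by omega) (by omega)

/-- Length of the longest common prefix of the suffixes of the reversed text of ranks `x`, `y`. -/
def rankLcp (T : ℕ → ℤ) (n : ℕ) (SA : ℕ → ℕ) (x y : ℕ) : ℕ :=
  lcpLen (sfx (Trev T n) n (SA x)) (sfx (Trev T n) n (SA y))

theorem rankLcp_comm (T : ℕ → ℤ) (n : ℕ) (SA : ℕ → ℕ) (x y : ℕ) :
    rankLcp T n SA x y = rankLcp T n SA y x :=
  lcpLen_comm _ _

theorem min_rankLcp_le (T : ℕ → ℤ) (n : ℕ) (SA : ℕ → ℕ) (x y z : ℕ) :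
    min (rankLcp T n SA x y) (rankLcp T n SA y z) ≤ rankLcp T n SA x z :=
  min_lcpLen_le _ _ _

namespace SASetup

variable {n σ : ℕ} {T : ℕ → ℤ} {dollar : ℤ} {SA : ℕ → ℕ}

theorem rankLcp_le_left (h : SASetup n σ T dollar SA) {x y z : ℕ} (hx : 1 ≤ x) (hxy : x ≤ y)
    (hyz : y ≤ z) (hz : z ≤ n) : rankLcp T n SA x z ≤ rankLcp T n SA x y := by
  rcases hxy.eq_or_lt with rfl | hxy
  · simpa [rankLcp, lcpLen_self] using lcpLen_le_left _ _
  rcases hyz.eq_or_lt with rfl | hyz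
  · exact le_rfl
  exact lcpLen_le_of_lex (h.hSAord _ _ hx hxy (by omega)) (h.hSAord _ _ (by omega) hyz hz)

theorem rankLcp_le_right (h : SASetup n σ T dollar SA) {x y z : ℕ} (hx : 1 ≤ x) (hxy : x ≤ y)
    (hyz : y ≤ z) (hz : z ≤ n) : rankLcp T n SA x z ≤ rankLcp T n SA y z := by
  have h₁ := h.rankLcp_le_left hx hxy hyz hz
  have h₂ := min_rankLcp_le T n SA y x z
  rw [rankLcp_comm T n SA y x] at h₂
  omega

theorem rankLcp_eq_lcpLen_reverse (h : SASetup n σ T dollar SA) {x z : ℕ} (hx : 1 ≤ x)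
    (hxn : x ≤ n) (hz : 1 ≤ z) (hzn : z ≤ n) (hxz : x ≠ z) :
    rankLcp T n SA x z =
      lcpLen (seg T 1 (n - SA x)).reverse (seg T 1 (n - SA z)).reverse := by
  obtain ⟨hx₁, hx₂⟩ := h.hSAmem x hx hxn
  obtain ⟨hz₁, hz₂⟩ := h.hSAmem z hz hzn
  have hT : ∀ i, 1 ≤ i → i < n → T i ≠ T n := by
    intro i h₁ h₂
    rw [h.hTn]
    exact h.hTne i h₁ h₂
  rw [rankLcp, sfx_Trev T hx₂, sfx_Trev T hz₂]
  apply lcpLen_append_terminator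
  · rw [List.mem_reverse]
    exact terminator_notMem_seg hT (by omega)
  · rw [List.mem_reverse]
    exact terminator_notMem_seg hT (by omega)
  · intro he
    have := congrArg List.length he
    simp only [List.length_reverse, seg_length] at this
    exact hxz (h.hSAinj x z hx hxn hz hzn (by omega))

end SASetup

theorem LCPSetup.le_rankLcp {n σ : ℕ} {T : ℕ → ℤ} {dollar : ℤ} {SA : ℕ → ℕ} {LCP : ℕ → ℤ}
    (h : LCPSetup n σ T dollar SA LCP) {v : ℤ} {x y : ℕ} (hx : 1 ≤ x) (hxy : x < y)
    (hy : y ≤ n) (hv : ∀ k, x < k → k ≤ y → v ≤ LCP k) : v ≤ rankLcp T n SA x y := by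
  induction y, hxy using Nat.le_induction with
  | base =>
    have := h.hLCP (x + 1) (by omega) hy
    rw [Nat.add_sub_cancel] at this
    rw [rankLcp, ← this]
    exact hv _ (by omega) le_rfl
  | succ y hxy ih =>
    have h₁ := ih (by omega) (fun k hk hky => hv k hk (by omega))
    have h₂ := h.hLCP (y + 1) (by omega) hy
    rw [Nat.add_sub_cancel, ← rankLcp] at h₂
    have h₃ := hv (y + 1) (by omega) le_rfl
    have h₄ := min_rankLcp_le T n SA x y (y + 1)
    omega

namespace FullSetup

variable {n σ : ℕ} {T : ℕ → ℤ} {dollar : ℤ} {SA : ℕ → ℕ} {BWT LCP w : ℕ → ℤ}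

theorem exists_bwt_ne (x : ℕ) (hx : 1 ≤ x) (hxn : x ≤ n) (hb : RunBoundary BWT n x) :
    ∃ z, 1 ≤ z ∧ z ≤ n ∧ BWT z ≠ BWT x := by
  rcases hb with ⟨h₁, h₂⟩ | ⟨h₁, h₂⟩
  · exact ⟨x - 1, by omega, by omega, h₂.symm⟩
  · exact ⟨x + 1, by omega, by omega, h₂.symm⟩

theorem exists_rightMax (h : FullSetup n σ T dollar SA BWT LCP w) {x z : ℕ} (hx : 1 ≤ x)
    (hxn : x ≤ n) (hz : 1 ≤ z) (hzn : z ≤ n) (hne : BWT z ≠ BWT x) :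
    ∃ s : List ℤ, RightMax T n σ s ∧ s <:+ seg T 1 (n - SA x) ∧
      rankLcp T n SA x z = s.length := by
  obtain ⟨hx₁, hx₂⟩ := h.hSAmem x hx hxn
  obtain ⟨hz₁, hz₂⟩ := h.hSAmem z hz hzn
  rw [h.hBWT x hx hxn, h.hBWT z hz hzn] at hne
  rw [h.rankLcp_eq_lcpLen_reverse hx hxn hz hzn (by rintro rfl; exact hne rfl)]
  set A := seg T 1 (n - SA x)
  set B := seg T 1 (n - SA z)
  have hA : (A.reverse.take (lcpLen A.reverse B.reverse)).reverse <:+ A := by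
    rw [← List.reverse_prefix, List.reverse_reverse]
    exact List.take_prefix _ _
  have hB : (A.reverse.take (lcpLen A.reverse B.reverse)).reverse <:+ B := by
    rw [← List.reverse_prefix, List.reverse_reverse]
    exact take_lcpLen_prefix _ _
  have hTx := h.hT (n - SA x + 1) (by omega) (by omega)
  have hTz := h.hT (n - SA z + 1) (by omega) (by omega)
  refine ⟨_, ⟨_, _, hne, hTz.1, hTz.2, hTx.1, hTx.2, ?_, ?_⟩, hA, ?_⟩
  · exact (occursIn_append_singleton _ _ _ _).2 ⟨_, by omega, rfl, hB⟩
  · exact (occursIn_append_singleton _ _ _ _).2 ⟨_, by omega, rfl, hA⟩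
  · rw [List.length_reverse, List.length_take, min_eq_left (lcpLen_le_left _ _)]

theorem isGreatest_weight (h : FullSetup n σ T dollar SA BWT LCP w) {x : ℕ} (hx : 1 ≤ x)
    (hxn : x ≤ n) (hb : RunBoundary BWT n x) :
    IsGreatest {m : ℤ | ∃ s : List ℤ, RightMax T n σ s ∧ s <:+ seg T 1 (n - SA x) ∧
      m = (s.length : ℤ)} (w x) := by
  obtain ⟨z, hz, hzn, hne⟩ := exists_bwt_ne x hx hxn hb
  obtain ⟨s, hs, hsx, -⟩ := h.exists_rightMax hx hxn hz hzn hne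
  exact h.hwRB x hx hxn hb ⟨s, hs, hsx⟩

theorem rankLcp_le_weight (h : FullSetup n σ T dollar SA BWT LCP w) {x z : ℕ} (hx : 1 ≤ x)
    (hxn : x ≤ n) (hb : RunBoundary BWT n x) (hz : 1 ≤ z) (hzn : z ≤ n)
    (hne : BWT z ≠ BWT x) : (rankLcp T n SA x z : ℤ) ≤ w x := by
  obtain ⟨s, hs, hsx, hl⟩ := h.exists_rightMax hx hxn hz hzn hne
  exact (h.isGreatest_weight hx hxn hb).2 ⟨s, hs, hsx, by rw [hl]⟩

theorem exists_weight_eq_rankLcp (h : FullSetup n σ T dollar SA BWT LCP w) {x : ℕ}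
    (hx : 1 ≤ x) (hxn : x ≤ n) (hb : RunBoundary BWT n x) :
    ∃ z, 1 ≤ z ∧ z ≤ n ∧ BWT z ≠ BWT x ∧ w x = rankLcp T n SA x z := by
  obtain ⟨s, ⟨a, a', hne, -, -, -, -, ha, ha'⟩, hsx, hl⟩ := (h.isGreatest_weight hx hxn hb).1
  obtain ⟨c, hc, hcx⟩ : ∃ c, c ≠ BWT x ∧ OccursIn T n (s ++ [c]) := by
    by_cases hax : a = BWT x
    · exact ⟨a', fun h => hne (hax.trans h.symm), ha'⟩
    · exact ⟨a, hax, ha⟩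
  obtain ⟨m, hm, rfl, hsm⟩ := (occursIn_append_singleton _ _ _ _).1 hcx
  obtain ⟨z, hz, hzn, hSAz⟩ := h.hSAsurj (n - m) (by omega) (by omega)
  have hm' : n - SA z = m := by omega
  have hne' : BWT z ≠ BWT x := by rwa [h.hBWT z hz hzn, hm']
  refine ⟨z, hz, hzn, hne', le_antisymm ?_ (h.rankLcp_le_weight hx hxn hb hz hzn hne')⟩
  rw [h.rankLcp_eq_lcpLen_reverse hx hxn hz hzn (by rintro rfl; exact hne' rfl), hl, hm',
    ← List.length_reverse]
  exact_mod_cast length_le_lcpLen (List.reverse_prefix.2 hsx) (List.reverse_prefix.2 hsm)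

theorem weight_nonneg_iff (h : FullSetup n σ T dollar SA BWT LCP w) {x : ℕ} (hx : 1 ≤ x)
    (hxn : x ≤ n) : 0 ≤ w x ↔ RunBoundary BWT n x := by
  constructor
  · intro h₀
    by_contra hb
    have := h.hwNot x hx hxn hb
    omega
  · intro hb
    obtain ⟨z, -, -, -, hw⟩ := h.exists_weight_eq_rankLcp hx hxn hb
    omega

theorem neg_one_le_weight (h : FullSetup n σ T dollar SA BWT LCP w) {x : ℕ} (hx : 1 ≤ x)
    (hxn : x ≤ n) : -1 ≤ w x := by
  by_cases hb : RunBoundary BWT n x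
  · have := (h.weight_nonneg_iff hx hxn).2 hb
    omega
  · exact (h.hwNot x hx hxn hb).ge

end FullSetup

theorem bIdx_spec (L : ℕ → ℤ) {x : ℕ} (hx : 1 < x) :
    1 ≤ bIdx L x ∧ bIdx L x < x ∧ ∀ k, bIdx L x < k → k ≤ x → L x ≤ L k := by
  have hbdd : BddAbove {y : ℕ | (1 ≤ y ∧ y < x ∧ L y < L x) ∨ y = 1} :=
    ⟨x, by rintro y (h | h) <;> omega⟩
  have hmem := Nat.sSup_mem (s := {y : ℕ | (1 ≤ y ∧ y < x ∧ L y < L x) ∨ y = 1})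
    ⟨1, Or.inr rfl⟩ hbdd
  refine ⟨?_, ?_, fun k hk hkx => ?_⟩
  · rcases hmem with h | h <;> unfold bIdx <;> omega
  · rcases hmem with h | h <;> unfold bIdx <;> omega
  · by_contra! hlt
    have hkx' : k < x := hkx.lt_of_ne (by rintro rfl; exact lt_irrefl _ hlt)
    exact absurd (le_csSup hbdd (Or.inl ⟨by omega, hkx', hlt⟩)) (not_le.2 hk)

theorem le_bIdx (L : ℕ → ℤ) {x y : ℕ} (hy : 1 ≤ y) (hyx : y < x) (hL : L y < L x) :
    y ≤ bIdx L x :=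
  le_csSup ⟨x, by rintro z (h | h) <;> omega⟩ (Or.inl ⟨hy, hyx, hL⟩)

theorem le_pIdx (BWT w : ℕ → ℤ) {c : ℤ} {i j : ℕ} (hj : 1 ≤ j) (hji : j < i) (hw : -1 < w j)
    (hc : BWT j = c) : j ≤ pIdx BWT w c i :=
  le_csSup ⟨i, by rintro z (h | h) <;> omega⟩ (Or.inl ⟨hj, hji, hw, hc⟩)

theorem pIdx_spec (BWT w : ℕ → ℤ) {c : ℤ} {i : ℕ}
    (hex : ∃ j : ℕ, 1 ≤ j ∧ j < i ∧ -1 < w j ∧ BWT j = c) :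
    1 ≤ pIdx BWT w c i ∧ pIdx BWT w c i < i ∧ -1 < w (pIdx BWT w c i) ∧
      BWT (pIdx BWT w c i) = c := by
  obtain ⟨j, hj, hji, hwj, hc⟩ := hex
  have hle := le_pIdx BWT w hj hji hwj hc
  have hmem := Nat.sSup_mem
    (s := {j : ℕ | (1 ≤ j ∧ j < i ∧ -1 < w j ∧ BWT j = c) ∨ j = 0})
    ⟨0, Or.inr rfl⟩ ⟨i, by rintro z (h | h) <;> omega⟩
  rcases hmem with h | h
  · exact h
  · rw [pIdx, h] at hle
    omega

/-- The last index of a range is its candidate if it strictly dominates all earlier weights. -/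
theorem Candt_eq_last (BWT w : ℕ → ℤ) {a i : ℕ} (hai : a ≤ i) (hwi : 0 ≤ w i)
    (hlt : ∀ y, a ≤ y → y < i → BWT y = BWT i → 0 ≤ w y → w y < w i) :
    Candt BWT w (BWT i) a (i + 1) = i := by
  have hle : ∀ y, a ≤ y → y < i + 1 → BWT y = BWT i → 0 ≤ w y → w y ≤ w i := by
    intro y hay hyi hy hwy
    rcases (Nat.lt_succ_iff.1 hyi).eq_or_lt with rfl | hyi
    · exact le_rfl
    · exact (hlt y hay hyi hy hwy).le
  have hmax : wMax BWT w (BWT i) a (i + 1) = w i := by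
    have hg : IsGreatest {m : ℕ | ∃ q : ℕ, a ≤ q ∧ q < i + 1 ∧ BWT q = BWT i ∧ 0 ≤ w q ∧
        (m : ℤ) = w q} (w i).toNat := by
      refine ⟨⟨i, hai, by omega, rfl, hwi, by omega⟩, ?_⟩
      rintro m ⟨q, haq, hqi, hq, hwq, hm⟩
      have := hle q haq hqi hq hwq
      omega
    rw [wMax, hg.csSup_eq]
    omega
  rw [Candt, if_pos ⟨i, hai, by omega, rfl, hwi⟩, hmax]
  have hl : IsLeast {p : ℕ | a ≤ p ∧ p < i + 1 ∧ BWT p = BWT i ∧ w p = w i} i := by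
    refine ⟨⟨hai, by omega, rfl, rfl⟩, ?_⟩
    rintro p ⟨hap, hpi, hp, hwp⟩
    by_contra! hlt'
    exact absurd hwp (hlt p hap hlt' hp (by omega)).ne
  rw [hl.csInf_eq]

/-- Between an index with another letter and `i` there is a start-run boundary of `BWT i`. -/
theorem exists_startRun (BWT : ℕ → ℤ) {z i : ℕ} (hz : 1 ≤ z) (hzi : z < i)
    (hne : BWT z ≠ BWT i) : ∃ p, z < p ∧ p ≤ i ∧ BWT p = BWT i ∧ StartRun BWT p := by
  induction i, hzi using Nat.le_induction with
  | base => exact ⟨z + 1, by omega, le_rfl, rfl, by omega, by simpa using hne.symm⟩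
  | succ k hk ih =>
    by_cases h : BWT k = BWT (k + 1)
    · obtain ⟨p, h₁, h₂, h₃, h₄⟩ := ih (by rwa [h])
      exact ⟨p, h₁, by omega, h₃.trans h, h₄⟩
    · exact ⟨k + 1, by omega, le_rfl, rfl, by omega, fun h' => h (by simpa using h'.symm)⟩

/-- Let `1 < i ≤ n`, `c := BWT[i]`, `ℓ* := i` if `w(i) = LCP[i]` and `ℓ* := i+1`
otherwise, `curr_b := b(ℓ*)`. If (C1) `w(i) > LCP[i]`, or (C2) `w(i) > -1` and
`pIdx(c, i) < curr_b`, or (C3) `pW(c, i) < w(i)`, then `i = Candt_c(curr_b, i+1)`. -/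
theorem stmt14 (n σ : ℕ) (T : ℕ → ℤ) (dollar : ℤ) (SA : ℕ → ℕ) (BWT LCP w : ℕ → ℤ)
    (hsetup : FullSetup n σ T dollar SA BWT LCP w)
    (i : ℕ) (hi1 : 1 < i) (hin : i ≤ n)
    (lstar : ℕ) (hlstar : lstar = if w i = LCP i then i else i + 1)
    (currb : ℕ) (hcurrb : currb = bIdx LCP lstar)
    (hcond : LCP i < w i ∨
      (-1 < w i ∧ pIdx BWT w (BWT i) i < currb) ∨
      pW BWT w (BWT i) i < w i) :
    (i : ℤ) = Candt BWT w (BWT i) currb (i + 1) := by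
  have hi : 1 ≤ i := hi1.le
  have hLi := hsetup.hLCP i hi1 hin
  rw [← rankLcp] at hLi
  have hpW : -1 ≤ pW BWT w (BWT i) i := by
    unfold pW
    split_ifs with hex
    · exact (pIdx_spec BWT w hex).2.2.1.le
    · exact le_rfl
  have hwi : 0 ≤ w i := by omega
  have hb := (hsetup.weight_nonneg_iff hi hin).1 hwi
  obtain ⟨z, hz, hzn, hzne, hwz⟩ := hsetup.exists_weight_eq_rankLcp hi hin hb
  have hleft : z < i → w i ≤ LCP i := by
    intro hzi
    have := hsetup.rankLcp_le_right hz (by omega : z ≤ i - 1) (by omega) hin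
    rw [rankLcp_comm T n SA z i] at this
    omega
  have hright : i < z → w i ≤ LCP (i + 1) := by
    intro hzi
    have h₁ := hsetup.hLCP (i + 1) (by omega) (by omega)
    rw [Nat.add_sub_cancel, ← rankLcp] at h₁
    have h₂ := hsetup.rankLcp_le_left hi (Nat.le_succ i) hzi hzn
    simp only [Nat.succ_eq_add_one] at h₂
    omega
  have hzi : z ≠ i := by rintro rfl; exact hzne rfl
  have hstar : lstar = i ∧ w i = LCP i ∨ lstar = i + 1 ∧ w i ≠ LCP i := by
    rw [hlstar]
    split_ifs with h <;> simp [h]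
  obtain ⟨hb₁, hb₂, hb₃⟩ := bIdx_spec LCP (show 1 < lstar by omega)
  rw [← hcurrb] at hb₁ hb₂ hb₃
  symm
  apply Candt_eq_last BWT w (by omega) hwi
  intro y hby hyi hy hwy
  exfalso
  have hex : ∃ j : ℕ, 1 ≤ j ∧ j < i ∧ -1 < w j ∧ BWT j = BWT i :=
    ⟨y, by omega, hyi, by omega, hy⟩
  have hyp := le_pIdx BWT w (by omega) hyi (by omega) hy
  obtain ⟨hq₁, hq₂, hq₃, hq₄⟩ := pIdx_spec BWT w hex
  have hmaxq : ∀ j, 1 ≤ j → j < i → -1 < w j → BWT j = BWT i → j ≤ pIdx BWT w (BWT i) i :=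
    fun j h₁ h₂ h₃ h₄ => le_pIdx BWT w h₁ h₂ h₃ h₄
  rw [pW, if_pos hex] at hcond
  set q := pIdx BWT w (BWT i) i
  rcases hcond with hC1 | ⟨-, hC2⟩ | hC3
  · have h₁ : i < z := by
      by_contra hle
      have := hleft (by omega)
      omega
    have h₂ := hright h₁
    have hl : lstar = i + 1 := by omega
    have := le_bIdx LCP hi (Nat.lt_succ_self i) (by simp only [Nat.succ_eq_add_one]; omega)
    simp only [Nat.succ_eq_add_one] at this
    rw [← hl, ← hcurrb] at this
    omega
  · omega
  have hLstar : LCP lstar ≤ rankLcp T n SA q i :=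
    hsetup.le_rankLcp hq₁ hq₂ hin fun k h₁ h₂ => hb₃ k (by omega) (by omega)
  have hqi : w i ≤ rankLcp T n SA q i := by
    rcases hstar with ⟨hl, hw⟩ | ⟨hl, hw⟩
    · rw [hl, ← hw] at hLstar
      exact hLstar
    rcases lt_or_gt_of_ne hzi with hlt | hgt
    · rcases le_or_gt z q with hzq | hqz
      · have := hsetup.rankLcp_le_right hz hzq hq₂.le hin
        rw [rankLcp_comm T n SA z i] at this
        omega
      · obtain ⟨p, hzp, hpi, hp, hsp⟩ := exists_startRun BWT hz hlt hzne
        rcases hpi.eq_or_lt with rfl | hpi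
        · have h₁ := hsetup.rankLcp_le_weight hi hin hb (by omega : 1 ≤ p - 1) (by omega)
            hsp.2.symm
          rw [rankLcp_comm] at h₁
          have := hleft hlt
          omega
        · have h₁ := (hsetup.weight_nonneg_iff (by omega : 1 ≤ p) (by omega)).2 (Or.inl hsp)
          have := hmaxq p (by omega) hpi (by omega) hp
          omega
    · have := hright hgt
      rw [hl] at hLstar
      omega
  have hbq := (hsetup.weight_nonneg_iff hq₁ (by omega : q ≤ n)).1 (by omega)
  have h₁ := hsetup.rankLcp_le_weight hq₁ (by omega) hbq hz hzn (by rwa [hq₄])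
  have h₂ := min_rankLcp_le T n SA q i z
  omega
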